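/- Let λ ∈ ℝ, let 0 ≤ p ≤ 1, let Y be a Bernoulli random variable with probability of success p (P(Y=1) = p, P(Y=0) = 1−p), let x ∈ [0,1], and let n ≥ k ≥ 0 be integers. Then B_{k,n}^Y(x|λ)/k! = C(n,k) · C_λ(x,k) · ∑_{l=0}^{n−k} p^l · C(1−x, l) · l! · {n−k \brace l}_λ. -/

import Mathlib

open MeasureTheory Filter Finset Topology

/-- The degenerate falling factorial `(x)_{n,λ} = x(x-λ)(x-2λ)⋯(x-(n-1)λ)`. -/
noncomputable def degFallFac (lam x : ℝ) : ℕ → ℝ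
  | 0 => 1
  | n + 1 => degFallFac lam x n * (x - n * lam)

/-- The degenerate exponential `e_λ^y(t) = (1+λt)^{y/λ}` for `λ ≠ 0`, and `e^{yt}` for `λ = 0`. -/
noncomputable def degExp (lam y t : ℝ) : ℝ :=
  if lam = 0 then Real.exp (y * t) else (1 + lam * t) ^ (y / lam)

/-- The generalized binomial coefficient `C(a,j) = a(a-1)⋯(a-j+1)/j!`. -/
noncomputable def genBinom (a : ℝ) (j : ℕ) : ℝ :=
  (∏ i ∈ Finset.range j, (a - (i : ℝ))) / (j.factorial : ℝ)

/-- The degenerate binomial coefficient `C_λ(x,k) = (x)_{k,λ}/k!`. -/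
noncomputable def degBinom (lam x : ℝ) (k : ℕ) : ℝ :=
  degFallFac lam x k / (k.factorial : ℝ)

theorem degExp_zero_left (lam t : ℝ) : degExp lam 0 t = 1 := by
  simp [degExp]

theorem genBinom_eq_choose (a : ℝ) (j : ℕ) : genBinom a j = Ring.choose a j := by
  rw [genBinom, Ring.choose_eq_smul, Polynomial.descPochhammer_smeval_eq_ascPochhammer,
    Polynomial.ascPochhammer_smeval_cast, Polynomial.ascPochhammer_smeval_eq_eval,
    ← descPochhammer_eval_eq_ascPochhammer, descPochhammer_eval_eq_prod_range, smul_eq_mul,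
    div_eq_inv_mul]

/-- The expectation of a function of a Bernoulli random variable. -/
theorem integral_comp_bernoulli {Ω : Type*} [MeasurableSpace Ω] {μ : Measure Ω}
    [IsProbabilityMeasure μ] {Y : Ω → ℝ} (hYm : Measurable Y) {p : ℝ} (hp0 : 0 ≤ p) (hp1 : p ≤ 1)
    (hlaw1 : μ {ω | Y ω = 1} = ENNReal.ofReal p)
    (hlaw0 : μ {ω | Y ω = 0} = ENNReal.ofReal (1 - p)) (f : ℝ → ℝ) :
    ∫ ω, f (Y ω) ∂μ = f 0 + p * (f 1 - f 0) := by
  have hm1 : MeasurableSet {ω | Y ω = 1} := hYm (measurableSet_singleton 1)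
  have hm0 : MeasurableSet {ω | Y ω = 0} := hYm (measurableSet_singleton 0)
  have hdisj : Disjoint {ω | Y ω = 1} {ω | Y ω = 0} :=
    Set.disjoint_left.2 fun ω h1 h0 => one_ne_zero (h1.symm.trans h0)
  have hae : ∀ᵐ ω ∂μ, ω ∈ {ω | Y ω = 1} ∪ {ω | Y ω = 0} := by
    refine (mem_ae_iff_prob_eq_one (hm1.union hm0)).2 ?_
    rw [measure_union hdisj hm0, hlaw1, hlaw0, ← ENNReal.ofReal_add hp0 (by linarith)]
    simp
  have hf : (fun ω => f (Y ω)) =ᵐ[μ]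
      fun ω => f 0 + {ω | Y ω = 1}.indicator (fun _ => f 1 - f 0) ω := by
    filter_upwards [hae] with ω hω
    rcases hω with h | h <;> simp only [Set.mem_ofPred_eq] at h <;> simp [Set.indicator, h]
  rw [integral_congr_ae hf, integral_add (integrable_const _)
    ((integrable_const _).indicator hm1), integral_indicator_const _ hm1]
  simp [measureReal_def, hlaw1, ENNReal.toReal_ofReal hp0]

/-- Taylor's estimate for a function that is the sum of a power series near `0`. -/
theorem isBigO_sub_sum_of_hasSum {f : ℝ → ℝ} {b : ℕ → ℝ}
    (h : ∀ᶠ t in 𝓝 (0 : ℝ), HasSum (fun n => b n * t ^ n) (f t)) (N : ℕ) :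
    (fun t => f t - ∑ i ∈ Finset.range N, b i * t ^ i) =O[𝓝 0] fun t => t ^ N := by
  have hps : HasFPowerSeriesAt f (FormalMultilinearSeries.ofScalars ℝ b) 0 := by
    rw [hasFPowerSeriesAt_iff]
    filter_upwards [h] with t ht
    simpa [FormalMultilinearSeries.coeff_ofScalars, mul_comm] using ht
  have := hps.isBigO_sub_partialSum_pow N
  simp only [zero_add, FormalMultilinearSeries.partialSum, ← norm_pow] at this
  simpa [FormalMultilinearSeries.ofScalars_apply_eq, mul_comm] using this.of_norm_right

/-- The coefficients of a power series with sum `O(t ^ N)` vanish below order `N`. -/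
theorem coeff_eq_zero_of_isBigO {f : ℝ → ℝ} {b : ℕ → ℝ}
    (h : ∀ᶠ t in 𝓝 (0 : ℝ), HasSum (fun n => b n * t ^ n) (f t)) {N : ℕ}
    (hf : f =O[𝓝 0] fun t => t ^ N) {m : ℕ} (hm : m < N) : b m = 0 := by
  induction m using Nat.strong_induction_on with
  | _ m ih =>
    have hsum : ∀ t : ℝ, ∑ i ∈ Finset.range (m + 1), b i * t ^ i = b m * t ^ m := fun t => by
      rw [Finset.sum_range_succ, Finset.sum_eq_zero, zero_add]
      intro i hi
      rw [ih i (Finset.mem_range.1 hi) ((Finset.mem_range.1 hi).trans hm), zero_mul]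
    have hrem := isBigO_sub_sum_of_hasSum h (m + 1)
    simp only [hsum] at hrem
    have hlo : ∀ {j : ℕ}, m < j → (fun t : ℝ => t ^ j) =o[𝓝 0] fun t => t ^ m :=
      fun hj => Asymptotics.isLittleO_pow_pow hj
    have hmain : (fun t : ℝ => b m * t ^ m) =o[𝓝 0] fun t => t ^ m := by
      simpa using (hf.trans_isLittleO (hlo hm)).sub (hrem.trans_isLittleO (hlo m.lt_succ_self))
    by_contra hb
    have hself := ((Asymptotics.isLittleO_const_mul_left_iff hb).1 hmain).mono
      (nhdsWithin_le_nhds (s := {(0 : ℝ)}ᶜ))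
    refine Asymptotics.isLittleO_irrefl ?_ hself
    refine Eventually.frequently ?_
    filter_upwards [self_mem_nhdsWithin] with t ht
    exact pow_ne_zero _ ht

/-- Multiplication by `t ^ k` shifts the coefficients of a power series. -/
theorem HasSum.pow_mul_shift {b : ℕ → ℝ} {s t : ℝ} (h : HasSum (fun n => b n * t ^ n) s) (k : ℕ) :
    HasSum (fun n => (if k ≤ n then b (n - k) else 0) * t ^ n) (t ^ k * s) := by
  rw [← (add_left_injective k).hasSum_iff]
  · convert! h.mul_left (t ^ k) using 1
    ext n
    simp only [Function.comp_apply, Nat.le_add_left, if_true, Nat.add_sub_cancel, pow_add]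
    ring
  · intro n hn
    have : ¬ k ≤ n := fun hkn => hn ⟨n - k, Nat.sub_add_cancel hkn⟩
    simp [this]

/-- Taylor's estimate for the binomial series. -/
theorem isBigO_one_add_rpow_sub_sum (a : ℝ) (N : ℕ) :
    (fun v : ℝ => (1 + v) ^ a - ∑ l ∈ Finset.range N, genBinom a l * v ^ l)
      =O[𝓝 0] fun v => v ^ N := by
  refine isBigO_sub_sum_of_hasSum ?_ N
  have h := hasFPowerSeriesAt_iff.1 (Real.one_add_rpow_hasFPowerSeriesAt_zero (a := a))
  filter_upwards [h] with v hv
  simpa [binomialSeries, FormalMultilinearSeries.coeff_ofScalars, genBinom_eq_choose,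
    mul_comm] using hv

/-- **Theorem 2.10.** For `Y` Bernoulli with probability of success `p`:
`B_{k,n}^Y(x|λ)/k! = C(n,k) C_λ(x,k) ∑_{l=0}^{n-k} p^l C(1-x,l) l! {n-k brace l}_λ`. -/
theorem bernoulli_probabilistic_degenerate_Bernstein_eq_sum_degStirling
    {Ω : Type*} [MeasurableSpace Ω] (μ : Measure Ω) [IsProbabilityMeasure μ]
    (Y : Ω → ℝ) (hYm : Measurable Y)
    (p : ℝ) (hp0 : 0 ≤ p) (hp1 : p ≤ 1)
    -- `Y` is Bernoulli with probability of success `p`: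
    (hlaw1 : μ {ω | Y ω = 1} = ENNReal.ofReal p)
    (hlaw0 : μ {ω | Y ω = 0} = ENNReal.ofReal (1 - p))
    (lam x : ℝ) (hx : x ∈ Set.Icc (0 : ℝ) 1)
    -- degenerate Stirling numbers of the second kind:
    (dSt : ℕ → ℕ → ℝ)
    (hdSt0 : ∀ n k : ℕ, n < k → dSt n k = 0)
    (hdSt : ∀ k : ℕ, ∀ᶠ t in 𝓝 (0 : ℝ),
      HasSum (fun n : ℕ => dSt n k * t ^ n / (n.factorial : ℝ))
        ((1 / (k.factorial : ℝ)) * (degExp lam 1 t - 1) ^ k))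
    -- probabilistic degenerate Bernstein polynomials:
    (B : ℕ → ℕ → ℝ)
    (hB0 : ∀ k n : ℕ, n < k → B k n = 0)
    (hB : ∀ k : ℕ, ∀ᶠ t in 𝓝 (0 : ℝ),
      HasSum (fun n : ℕ => B k n * t ^ n / (n.factorial : ℝ))
        ((1 / (k.factorial : ℝ)) * degFallFac lam x k * t ^ k *
          (∫ ω, degExp lam (Y ω) t ∂μ) ^ (1 - x)))
    (n k : ℕ) (hkn : k ≤ n) :
    B k n / (k.factorial : ℝ) = (n.choose k : ℝ) * degBinom lam x k *
      ∑ l ∈ Finset.range (n - k + 1),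
        p ^ l * genBinom (1 - x) l * (l.factorial : ℝ) * dSt (n - k) l := by
  have hE : ∀ t, ∫ ω, degExp lam (Y ω) t ∂μ = 1 + p * (degExp lam 1 t - 1) := fun t => by
    rw [integral_comp_bernoulli hYm hp0 hp1 hlaw1 hlaw0 (fun y => degExp lam y t),
      degExp_zero_left]
  set u : ℝ → ℝ := fun t => degExp lam 1 t - 1 with hu
  set c : ℝ := 1 / (k.factorial : ℝ) * degFallFac lam x k with hc
  set w : ℕ → ℝ := fun l => p ^ l * genBinom (1 - x) l * (l.factorial : ℝ) with hw
  obtain ⟨m, rfl⟩ := Nat.exists_eq_add_of_le hkn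
  have hu_bigO : u =O[𝓝 0] fun t => t := by
    have h1 := isBigO_sub_sum_of_hasSum (f := u) (b := fun n => dSt n 1 / (n.factorial : ℝ))
      (by filter_upwards [hdSt 1] with t ht
          simpa [hu, mul_div_right_comm] using ht) 1
    simpa [hdSt0 0 1 one_pos] using h1
  have hpu : (fun t => p * u t) =O[𝓝 0] fun t => t := hu_bigO.const_mul_left p
  have hrem : (fun t => c * t ^ k * ((1 + p * u t) ^ (1 - x) -
      ∑ l ∈ Finset.range (m + 1), genBinom (1 - x) l * (p * u t) ^ l))
      =O[𝓝 0] fun t => t ^ (k + m + 1) := by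
    have h1 := ((isBigO_one_add_rpow_sub_sum (1 - x) (m + 1)).comp_tendsto
      (hpu.trans_tendsto tendsto_id)).trans (hpu.pow (m + 1))
    have h2 := ((Asymptotics.isBigO_refl (fun t : ℝ => t ^ k) (𝓝 0)).const_mul_left c).mul h1
    simpa only [add_assoc, pow_add, Function.comp_def] using h2
  have hsum : ∀ᶠ t in 𝓝 (0 : ℝ), HasSum (fun j => (B k j / (j.factorial : ℝ) -
      c * if k ≤ j then ∑ l ∈ Finset.range (m + 1),
        w l * (dSt (j - k) l / ((j - k).factorial : ℝ)) else 0) * t ^ j)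
      (c * t ^ k * ((1 + p * u t) ^ (1 - x) -
        ∑ l ∈ Finset.range (m + 1), genBinom (1 - x) l * (p * u t) ^ l)) := by
    filter_upwards [hB k, (Finset.eventually_all (Finset.range (m + 1))).2 fun l _ => hdSt l]
      with t hBt hSt
    have h1 : HasSum (fun j => (∑ l ∈ Finset.range (m + 1),
        w l * (dSt j l / (j.factorial : ℝ))) * t ^ j)
        (∑ l ∈ Finset.range (m + 1), genBinom (1 - x) l * (p * u t) ^ l) := by
      convert! hasSum_sum fun l hl => (hSt l hl).mul_left (w l) using 1
      · ext j
        rw [Finset.sum_mul]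
        exact Finset.sum_congr rfl fun l _ => by ring
      · refine Finset.sum_congr rfl fun l _ => ?_
        have : (l.factorial : ℝ) ≠ 0 := by positivity
        simp only [hw, hu, mul_pow]
        field_simp
    rw [hE] at hBt
    convert! hBt.sub ((h1.pow_mul_shift k).mul_left c) using 1
    · ext j
      ring
    · simp only [hc, hu]
      ring
  have hcoeff := coeff_eq_zero_of_isBigO hsum hrem (Nat.lt_succ_self (k + m))
  simp only [Nat.le_add_right, if_true, Nat.add_sub_cancel_left, ← mul_div_assoc,
    ← Finset.sum_div] at hcoeff ⊢
  have hB_eq : B k (k + m) = ((k + m).factorial : ℝ) * (c *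
      (∑ l ∈ Finset.range (m + 1), w l * dSt m l) / (m.factorial : ℝ)) := by
    have : ((k + m).factorial : ℝ) ≠ 0 := by positivity
    rw [← sub_eq_zero.1 hcoeff]
    field_simp
  rw [hB_eq, Nat.cast_choose ℝ hkn, Nat.add_sub_cancel_left, degBinom, hc, hw]
  field_simp
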